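/- For every c in the interval (1/2, 1] and every x in [0,1], it holds that F(x) + c·(1 − x) ≥ P(c). -/

import Mathlib

open Real

noncomputable def R : ℝ := 1 / (1 + Real.log 2)

noncomputable def f (x : ℝ) : ℝ :=
  if x ≤ R then 1/2 else (2 * Real.exp 1) ^ (x - 1)

noncomputable def F (x : ℝ) : ℝ :=
  if x ≤ R then x/2 else R * (2 * Real.exp 1) ^ (x - 1)

noncomputable def P (c : ℝ) : ℝ := ∫ y in (0:ℝ)..1, min (f y) c

noncomputable def Q (c : ℝ) : ℝ := ∫ y in (0:ℝ)..1, max (c - f y) 0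

noncomputable def xic : ℝ := (1 + (2/3) * Real.log (4/3)) * R - 2/3

noncomputable def phi : ℝ := (2/3) * xic / (2/3 - R + xic)

noncomputable def xi (x : ℝ) : ℝ :=
  if x ≤ 1/3 then xic / x else 9 * xic * (1 - 2 * x)

noncomputable def T (a b : ℝ) : ℝ := (a + b - 1/2) * (xi b - xi a)

noncomputable def pile (x : ℝ) : ℝ := max (2/3) (2 * x)

theorem R_pos : 0 < R := by
  have := Real.log_pos one_lt_two
  unfold R; positivity

theorem two_exp_rpow (y : ℝ) : (2 * Real.exp 1) ^ (y - 1) = Real.exp ((y - 1) / R) := by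
  have h : Real.log (2 * Real.exp 1) = 1 / R := by
    rw [Real.log_mul two_ne_zero (Real.exp_ne_zero _), Real.log_exp, R, one_div_one_div, add_comm]
  rw [Real.rpow_def_of_pos (by positivity), h]
  congr 1
  ring

theorem exp_sub_one_div_R : Real.exp ((R - 1) / R) = 1 / 2 := by
  have h : (R - 1) / R = -Real.log 2 := by
    rw [sub_div, div_self R_pos.ne', R, one_div_one_div]
    ring
  rw [h, Real.exp_neg, Real.exp_log two_pos, one_div]

theorem f_eq_max (y : ℝ) : f y = max (1 / 2) (Real.exp ((y - 1) / R)) := by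
  have hR := R_pos
  unfold f
  split_ifs with h
  · rw [max_eq_left]
    rw [← exp_sub_one_div_R]
    gcongr
  · rw [two_exp_rpow, max_eq_right]
    rw [← exp_sub_one_div_R]
    push Not at h
    gcongr

theorem continuous_f : Continuous f := by
  rw [funext f_eq_max]
  fun_prop

theorem integral_f_of_le {x : ℝ} (h0 : 0 ≤ x) (hx : x ≤ R) : ∫ y in (0 : ℝ)..x, f y = x / 2 := by
  have h : ∫ y in (0 : ℝ)..x, f y = ∫ _ in (0 : ℝ)..x, (1 / 2 : ℝ) := by
    refine intervalIntegral.integral_congr fun y hy => ?_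
    rw [Set.uIcc_of_le h0] at hy
    exact if_pos (hy.2.trans hx)
  rw [h, intervalIntegral.integral_const, smul_eq_mul]
  ring

theorem integral_f_from_R {x : ℝ} (hx : R ≤ x) :
    ∫ y in R..x, f y = R * Real.exp ((x - 1) / R) - R / 2 := by
  have hR := R_pos
  have h : ∀ y ∈ Set.uIcc R x, HasDerivAt (fun y => R * Real.exp ((y - 1) / R)) (f y) y := by
    intro y hy
    rw [Set.uIcc_of_le hx] at hy
    have hf : f y = R * (Real.exp ((y - 1) / R) * (1 / R)) := by
      rw [f_eq_max, max_eq_right]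
      · field_simp
      · rw [← exp_sub_one_div_R]
        have := hy.1
        gcongr
    rw [hf]
    exact ((((hasDerivAt_id y).sub_const 1).div_const R).exp).const_mul R
  rw [intervalIntegral.integral_eq_sub_of_hasDerivAt h (continuous_f.intervalIntegrable _ _),
    exp_sub_one_div_R]
  ring

theorem integral_f {x : ℝ} (h0 : 0 ≤ x) : ∫ y in (0 : ℝ)..x, f y = F x := by
  unfold F
  split_ifs with h
  · exact integral_f_of_le h0 h
  · rw [← intervalIntegral.integral_add_adjacent_intervals
      (continuous_f.intervalIntegrable 0 R) (continuous_f.intervalIntegrable R x),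
      integral_f_of_le R_pos.le le_rfl, integral_f_from_R (not_le.1 h).le, two_exp_rpow]
    ring

theorem stmt_7 : ∀ c ∈ Set.Ioc (1/2 : ℝ) 1, ∀ x ∈ Set.Icc (0:ℝ) 1,
    F x + c * (1 - x) ≥ P c := by
  intro c _ x hx
  have hmin : Continuous fun y => min (f y) c := continuous_f.min continuous_const
  have h1 : ∫ y in (0 : ℝ)..x, min (f y) c ≤ ∫ y in (0 : ℝ)..x, f y :=
    intervalIntegral.integral_mono hx.1 (hmin.intervalIntegrable _ _)
      (continuous_f.intervalIntegrable _ _) fun y => min_le_left _ _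
  have h2 : ∫ y in x..1, min (f y) c ≤ ∫ _ in x..1, c :=
    intervalIntegral.integral_mono hx.2 (hmin.intervalIntegrable _ _)
      (continuous_const.intervalIntegrable _ _) fun y => min_le_right _ _
  rw [integral_f hx.1] at h1
  rw [intervalIntegral.integral_const, smul_eq_mul] at h2
  rw [P, ← intervalIntegral.integral_add_adjacent_intervals
    (hmin.intervalIntegrable 0 x) (hmin.intervalIntegrable x 1)]
  linarith
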